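/- arXiv:2409.02450 — 3 statements merged into one kernel-verified Lean document; each statement's English description precedes it below -/
import Mathlib

section
/- Let h : (0,∞) → (0,∞) be a continuous multiplicative function (h(xy) = h(x)h(y) for all x, y > 0) satisfying h(t) ≥ t for all t > 0, and let f : [a,b] → ℝ be a continuous h-mid-convex function. Then f is h-convex on [a,b], i.e. for all x, y ∈ [a,b] and all t ∈ (0,1), f(t·x + (1−t)·y) ≤ h(t)·f(x) + h(1−t)·f(y). -/
/-- A multiplicative function on `(0, ∞)` that dominates the identity is the identity. -/
theorem eq_self_of_mul_of_le {h : ℝ → ℝ}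
    (h_mul : ∀ x y : ℝ, 0 < x → 0 < y → h (x * y) = h x * h y)
    (h_ge : ∀ t : ℝ, 0 < t → t ≤ h t) {t : ℝ} (ht : 0 < t) : h t = t := by
  have h_one : h 1 = 1 := by
    have hm := h_mul 1 1 one_pos one_pos
    have hg := h_ge 1 one_pos
    rw [one_mul] at hm
    nlinarith
  have hm := h_mul t t⁻¹ ht (inv_pos.2 ht)
  rw [mul_inv_cancel₀ ht.ne', h_one] at hm
  refine le_antisymm ?_ (h_ge t ht)
  have hle : h t * t⁻¹ ≤ 1 := hm ▸
    mul_le_mul_of_nonneg_left (h_ge _ (inv_pos.2 ht)) (ht.le.trans (h_ge t ht))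
  rwa [← div_eq_mul_inv, div_le_one ht] at hle

/-- A continuous midpoint convex function on `[0, 1]` vanishing at the endpoints is nonpositive. -/
theorem nonpos_of_midpoint_convex {g : ℝ → ℝ} (hg : ContinuousOn g (Set.Icc 0 1))
    (hmid : ∀ s ∈ Set.Icc (0 : ℝ) 1, ∀ t ∈ Set.Icc (0 : ℝ) 1,
      g ((s + t) / 2) ≤ (g s + g t) / 2)
    (h0 : g 0 = 0) (h1 : g 1 = 0) {t : ℝ} (ht : t ∈ Set.Icc (0 : ℝ) 1) : g t ≤ 0 := by
  obtain ⟨m, hm, hmax⟩ := isCompact_Icc.exists_isMaxOn ⟨t, ht⟩ hg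
  refine (hmax ht).trans ?_
  rcases le_total m (1 / 2) with hle | hle
  · have hmem : 2 * m ∈ Set.Icc (0 : ℝ) 1 := ⟨by linarith [hm.1], by linarith⟩
    have hconv := hmid 0 (by simp) _ hmem
    have hbound : g (2 * m) ≤ g m := hmax hmem
    rw [show (0 + 2 * m) / 2 = m by ring, h0] at hconv
    linarith
  · have hmem : 2 * m - 1 ∈ Set.Icc (0 : ℝ) 1 := ⟨by linarith, by linarith [hm.2]⟩
    have hconv := hmid 1 (by simp) _ hmem
    have hbound : g (2 * m - 1) ≤ g m := hmax hmem
    rw [show (1 + (2 * m - 1)) / 2 = m by ring, h1] at hconv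
    linarith

theorem h_mid_convex_continuous_implies_h_convex_multiplicative
    (a b : ℝ) (h f : ℝ → ℝ)
    (h_pos : ∀ t : ℝ, 0 < t → 0 < h t)
    (h_cont : ContinuousOn h (Set.Ioi (0 : ℝ)))
    (h_mul : ∀ x y : ℝ, 0 < x → 0 < y → h (x * y) = h x * h y)
    (h_ge : ∀ t : ℝ, 0 < t → t ≤ h t)
    (f_cont : ContinuousOn f (Set.Icc a b))
    (f_midconv : ∀ x ∈ Set.Icc a b, ∀ y ∈ Set.Icc a b,
      f ((x + y) / 2) ≤ h (1 / 2) * (f x + f y)) :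
    ∀ x ∈ Set.Icc a b, ∀ y ∈ Set.Icc a b, ∀ t ∈ Set.Ioo (0 : ℝ) 1,
      f (t * x + (1 - t) * y) ≤ h t * f x + h (1 - t) * f y := by
  intro x hx y hy t ht
  rw [eq_self_of_mul_of_le h_mul h_ge ht.1,
    eq_self_of_mul_of_le h_mul h_ge (sub_pos.2 ht.2)]
  rw [eq_self_of_mul_of_le h_mul h_ge one_half_pos] at f_midconv
  have hmaps : Set.MapsTo (fun s : ℝ => s * x + (1 - s) * y) (Set.Icc 0 1) (Set.Icc a b) :=
    fun s hs => convex_Icc a b hx hy hs.1 (sub_nonneg.2 hs.2) (by ring)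
  have hnonpos := nonpos_of_midpoint_convex
    (g := fun s => f (s * x + (1 - s) * y) - (s * f x + (1 - s) * f y))
    ((f_cont.comp (by fun_prop) hmaps).sub (by fun_prop))
    (fun s hs r hr => by
      have hconv := f_midconv _ (hmaps hs) _ (hmaps hr)
      dsimp only at hconv ⊢
      rw [show (s + r) / 2 * x + (1 - (s + r) / 2) * y =
        (s * x + (1 - s) * y + (r * x + (1 - r) * y)) / 2 by ring]
      linarith)
    (by simp) (by simp) (Set.Ioo_subset_Icc_self ht)
  exact sub_nonpos.1 hnonpos
end

section
/- Let h : (0,∞) → (0,∞) be a super-multiplicative function satisfying h(t) ≥ t for all t > 0, and let f : [a,b] → ℝ be an h-mid-convex function. Then for every n ∈ ℕ with n ≥ 1 and every x₁, …, xₙ ∈ [a,b], one has f((x₁ + x₂ + ⋯ + xₙ)/n) ≤ h(1/n)·(f(x₁) + f(x₂) + ⋯ + f(xₙ)). -/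
lemma eq_self_of_supermultiplicative {h : ℝ → ℝ}
    (h_supermul : ∀ x y : ℝ, 0 < x → 0 < y → h x * h y ≤ h (x * y))
    (h_ge : ∀ t : ℝ, 0 < t → t ≤ h t) {t : ℝ} (ht : 0 < t) : h t = t := by
  have one_le : 1 ≤ h 1 := h_ge 1 one_pos
  have h_one : h 1 ≤ 1 := by
    have := h_supermul 1 1 one_pos one_pos
    rw [one_mul] at this
    nlinarith
  refine le_antisymm ?_ (h_ge t ht)
  have hinv : 0 < t⁻¹ := inv_pos.2 ht
  have hmul := h_supermul t t⁻¹ ht hinv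
  rw [mul_inv_cancel₀ ht.ne'] at hmul
  have hle : h t * t⁻¹ ≤ 1 :=
    (mul_le_mul_of_nonneg_left (h_ge _ hinv) (ht.le.trans (h_ge t ht))).trans
      (hmul.trans h_one)
  rwa [← div_eq_mul_inv, div_le_one ht] at hle

lemma sum_range_div_mem {s : Set ℝ} (hs : Convex ℝ s) {n : ℕ} (hn : n ≠ 0) {x : ℕ → ℝ}
    (hx : ∀ i, x i ∈ s) : (∑ i ∈ Finset.range n, x i) / n ∈ s := by
  have hn' : (n : ℝ) ≠ 0 := Nat.cast_ne_zero.2 hn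
  have := hs.sum_mem (t := Finset.range n) (w := fun _ => (n : ℝ)⁻¹) (z := x)
    (fun _ _ => by positivity) (by simp [hn']) (fun i _ => hx i)
  rwa [← Finset.smul_sum, smul_eq_mul, inv_mul_eq_div] at this

/-- Jensen's inequality with equal weights for a midpoint convex function. -/
lemma mul_map_average_le_sum_of_midconvex {s : Set ℝ} (hs : Convex ℝ s) {f : ℝ → ℝ}
    (hf : ∀ x ∈ s, ∀ y ∈ s, f ((x + y) / 2) ≤ (f x + f y) / 2) (n : ℕ) :
    ∀ x : ℕ → ℝ, (∀ i, x i ∈ s) →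
      n * f ((∑ i ∈ Finset.range n, x i) / n) ≤ ∑ i ∈ Finset.range n, f (x i) := by
  refine Nat.cauchy_induction_two_mul (P := fun n => ∀ x : ℕ → ℝ, (∀ i, x i ∈ s) →
      n * f ((∑ i ∈ Finset.range n, x i) / n) ≤ ∑ i ∈ Finset.range n, f (x i))
    ?_ 0 ?_ ?_ n
  · intro n ih x hx
    rcases eq_or_ne n 0 with rfl | hn
    · simp
    have hn' : (n : ℝ) ≠ 0 := Nat.cast_ne_zero.2 hn
    set c := (∑ i ∈ Finset.range n, x i) / n with hc
    have hcs : c ∈ s := sum_range_div_mem hs hn hx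
    have sum_eq : ∀ g : ℝ → ℝ,
        ∑ i ∈ Finset.range (n + 1), g (if i < n then x i else c) =
          ∑ i ∈ Finset.range n, g (x i) + g c := by
      intro g
      rw [Finset.sum_range_succ, if_neg (lt_irrefl n)]
      congr 1
      exact Finset.sum_congr rfl fun i hi => by rw [if_pos (Finset.mem_range.1 hi)]
    have key := ih (fun i => if i < n then x i else c) fun i => by
      split_ifs <;> simp [hx, hcs]
    have havg : (∑ i ∈ Finset.range n, x i + c) / ((n + 1 : ℕ) : ℝ) = c := by
      have : ∑ i ∈ Finset.range n, x i = n * c := by rw [hc]; field_simp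
      rw [this]
      push_cast
      field_simp
    have hsum := sum_eq id
    simp only [id] at hsum
    rw [sum_eq f, hsum, havg] at key
    push_cast at key
    linarith
  · intro x _
    simp
  · intro m hm ih x hx
    have hm' : (m : ℝ) ≠ 0 := Nat.cast_ne_zero.2 hm.ne'
    have h1 := ih x hx
    have h2 := ih (fun i => x (m + i)) fun i => hx _
    have key := hf _ (sum_range_div_mem hs hm.ne' hx) _
      (sum_range_div_mem hs hm.ne' (x := fun i => x (m + i)) fun i => hx _)
    rw [two_mul, Finset.sum_range_add, Finset.sum_range_add]
    have havg : ∀ u v : ℝ, (u + v) / ((m + m : ℕ) : ℝ) = (u / m + v / m) / 2 := by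
      intro u v
      push_cast
      field_simp
      ring
    rw [havg]
    push_cast
    have := mul_le_mul_of_nonneg_left key (Nat.cast_nonneg (α := ℝ) m)
    linarith

theorem mean_jensen_for_h_mid_convex
    (a b : ℝ) (h f : ℝ → ℝ)
    (h_pos : ∀ t : ℝ, 0 < t → 0 < h t)
    (h_supermul : ∀ x y : ℝ, 0 < x → 0 < y → h x * h y ≤ h (x * y))
    (h_ge : ∀ t : ℝ, 0 < t → t ≤ h t)
    (f_midconv : ∀ x ∈ Set.Icc a b, ∀ y ∈ Set.Icc a b,
      f ((x + y) / 2) ≤ h (1 / 2) * (f x + f y)) :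
    ∀ (n : ℕ), 1 ≤ n → ∀ (x : Fin n → ℝ),
      (∀ i, x i ∈ Set.Icc a b) →
      f ((∑ i, x i) / n) ≤ h (1 / n) * ∑ i, f (x i) := by
  intro n hn x hx
  have hn' : (0 : ℝ) < n := Nat.cast_pos.2 hn
  rw [eq_self_of_supermultiplicative h_supermul h_ge (by norm_num)] at f_midconv
  rw [eq_self_of_supermultiplicative h_supermul h_ge (by positivity), one_div_mul_eq_div,
    le_div_iff₀' hn']
  let y : ℕ → ℝ := fun i => if hi : i < n then x ⟨i, hi⟩ else x ⟨0, hn⟩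
  have hy : ∀ i : Fin n, y i = x i := fun i => by simp [y]
  have key := mul_map_average_le_sum_of_midconvex (convex_Icc a b)
    (fun u hu v hv => (f_midconv u hu v hv).trans_eq (by ring)) n y fun i => by
      dsimp only [y]; split_ifs <;> exact hx _
  rw [Finset.sum_range, Finset.sum_range] at key
  simpa only [hy] using key
end

section
/- Let h : (0,∞) → (0,∞) be a super-multiplicative function satisfying h(t) ≥ t for all t > 0. Then for all natural numbers m, n with 2^(m−1) < n < 2^m, one has h(2^m/n)·(1 − h((2^m − n)/2^m)) ≥ 1. -/
/-- A positive super-multiplicative function on `(0, ∞)` which dominates the identity is the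
identity. -/
theorem eq_self_of_supermultiplicative_of_le
    (h : ℝ → ℝ)
    (h_pos : ∀ t : ℝ, 0 < t → 0 < h t)
    (h_supermul : ∀ x y : ℝ, 0 < x → 0 < y → h x * h y ≤ h (x * y))
    (h_ge : ∀ t : ℝ, 0 < t → t ≤ h t) {t : ℝ} (ht : 0 < t) : h t = t := by
  have h_one : h 1 ≤ 1 := by
    have hmul := h_supermul 1 1 one_pos one_pos
    rw [mul_one] at hmul
    exact (mul_le_iff_le_one_left (h_pos 1 one_pos)).mp hmul
  refine le_antisymm ?_ (h_ge t ht)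
  have hmul := h_supermul t t⁻¹ ht (inv_pos.mpr ht)
  rw [mul_inv_cancel₀ ht.ne'] at hmul
  have hle : h t * t⁻¹ ≤ 1 :=
    (mul_le_mul_of_nonneg_left (h_ge t⁻¹ (inv_pos.mpr ht)) (h_pos t ht).le).trans
      (hmul.trans h_one)
  rwa [← div_eq_mul_inv, div_le_one ht] at hle

theorem supermultiplicative_dyadic_inequality
    (h : ℝ → ℝ)
    (h_pos : ∀ t : ℝ, 0 < t → 0 < h t)
    (h_supermul : ∀ x y : ℝ, 0 < x → 0 < y → h x * h y ≤ h (x * y))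
    (h_ge : ∀ t : ℝ, 0 < t → t ≤ h t) :
    ∀ m n : ℕ, 2 ^ (m - 1) < n → n < 2 ^ m →
      h ((2 : ℝ) ^ m / (n : ℝ)) * (1 - h (((2 : ℝ) ^ m - (n : ℝ)) / (2 : ℝ) ^ m)) ≥ 1 := by
  intro m n hlow hhigh
  have hn : (0 : ℝ) < n := by exact_mod_cast (Nat.zero_le _).trans_lt hlow
  have hlt : (n : ℝ) < 2 ^ m := by exact_mod_cast hhigh
  have h_id := fun {t : ℝ} => eq_self_of_supermultiplicative_of_le h h_pos h_supermul h_ge (t := t)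
  rw [h_id (by positivity), h_id (div_pos (sub_pos.mpr hlt) (by positivity))]
  apply ge_of_eq
  field_simp
  ring
end
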